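/- Let (λ_k) be the Nesterov sequence λ_0 = 1, λ_{k+1} = (1 + √(1 + 4 λ_k²))/2. Let (ε_k)_{k ≥ 0} be nonnegative reals and for k ≥ 1 define the accumulated error ϑ_k = (1/λ_{k−1}²) Σ_{i=0}^{k−1} λ_i² ε_i. Then: (a) ϑ_{k+1} = ε_k + (1 − 1/λ_k) ϑ_k for all k ≥ 1; (b) if ε_k = ϑ_k/λ_k for every k ≥ 1, then ϑ_k = ε_0 for every k ≥ 1, and consequently ε_k = ε_0/λ_k ≤ 2ε_0/(k+2) for every k ≥ 1. -/

import Mathlib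

theorem nesterov_sq_eq {lam : ℕ → ℝ}
    (hrec : ∀ k : ℕ, lam (k + 1) = (1 + Real.sqrt (1 + 4 * lam k ^ 2)) / 2) (k : ℕ) :
    lam k ^ 2 = lam (k + 1) * (lam (k + 1) - 1) := by
  have h := Real.sq_sqrt (show (0 : ℝ) ≤ 1 + 4 * lam k ^ 2 by positivity)
  rw [hrec k]
  linarith

theorem nesterov_ge {lam : ℕ → ℝ} (h0 : lam 0 = 1)
    (hrec : ∀ k : ℕ, lam (k + 1) = (1 + Real.sqrt (1 + 4 * lam k ^ 2)) / 2) (k : ℕ) :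
    ((k : ℝ) + 2) / 2 ≤ lam k := by
  induction k with
  | zero => simp [h0]
  | succ k ih =>
    have h : 2 * lam k ≤ Real.sqrt (1 + 4 * lam k ^ 2) :=
      Real.le_sqrt_of_sq_le (by linarith [mul_pow 2 (lam k) 2])
    rw [hrec k]
    push_cast
    linarith

theorem stmt_14 (lam : ℕ → ℝ) (h0 : lam 0 = 1)
    (hrec : ∀ k : ℕ, lam (k + 1) = (1 + Real.sqrt (1 + 4 * lam k ^ 2)) / 2)
    (eps : ℕ → ℝ) (heps : ∀ k, 0 ≤ eps k)
    (vth : ℕ → ℝ)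
    (hvth : ∀ k : ℕ, 1 ≤ k →
      vth k = (1 / lam (k - 1) ^ 2) * ∑ i ∈ Finset.range k, lam i ^ 2 * eps i) :
    (∀ k : ℕ, 1 ≤ k → vth (k + 1) = eps k + (1 - 1 / lam k) * vth k) ∧
    ((∀ k : ℕ, 1 ≤ k → eps k = vth k / lam k) →
      (∀ k : ℕ, 1 ≤ k → vth k = eps 0) ∧
      (∀ k : ℕ, 1 ≤ k →
        eps k = eps 0 / lam k ∧ eps k ≤ 2 * eps 0 / ((k : ℝ) + 2))) := by
  have hpos : ∀ k, 0 < lam k := fun k =>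
    lt_of_lt_of_le (by positivity) (nesterov_ge h0 hrec k)
  have hstep : ∀ k : ℕ, 1 ≤ k → vth (k + 1) = eps k + (1 - 1 / lam k) * vth k := by
    intro k hk
    obtain ⟨m, rfl⟩ := Nat.exists_eq_add_of_le' hk
    have hsq := nesterov_sq_eq hrec m
    have hm := (hpos m).ne'
    have hm' := (hpos (m + 1)).ne'
    have hsub : lam (m + 1) - 1 ≠ 0 := fun h => by
      rw [h, mul_zero] at hsq
      exact pow_ne_zero 2 hm hsq
    rw [hvth (m + 1 + 1) (by omega), hvth (m + 1) hk, Finset.sum_range_succ _ (m + 1)]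
    simp only [Nat.add_sub_cancel]
    rw [hsq]
    field_simp
    ring
  refine ⟨hstep, fun heq => ?_⟩
  have hconst : ∀ k : ℕ, 1 ≤ k → vth k = eps 0 := by
    intro k hk
    induction k, hk using Nat.le_induction with
    | base => simp [hvth 1 le_rfl, h0]
    | succ k hk ih =>
      rw [hstep k hk, heq k hk, ih]
      ring
  refine ⟨hconst, fun k hk => ?_⟩
  have hk_eq : eps k = eps 0 / lam k := by rw [heq k hk, hconst k hk]
  refine ⟨hk_eq, ?_⟩
  calc eps k = eps 0 / lam k := hk_eq
    _ ≤ eps 0 / (((k : ℝ) + 2) / 2) :=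
      div_le_div_of_nonneg_left (heps 0) (by positivity) (nesterov_ge h0 hrec k)
    _ = 2 * eps 0 / ((k : ℝ) + 2) := by field_simp
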